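/- Let T be an ergodic measure-preserving invertible transformation of a probability space, B a measurable set, and (v_n) a sequence of positive integers such that for every fixed nonzero integer i, μ(T^{i v_n}(B) ∩ B) → μ(B)² as n → ∞. Then for every ε > 0 there exist arbitrarily large positive integers L such that for all sufficiently large n, ∫∫ |(1/L)∑_{i=0}^{L−1} χ_{B×B}∘(T×T)^{-i v_n} − μ(B)²| d(μ×μ) < ε. -/

import Mathlib

open MeasureTheory Filter Finset

/-- Integer iterate of an invertible transformation. -/
noncomputable def iterZ {X : Type*} [MeasurableSpace X] (T : X ≃ᵐ X) (k : ℤ) : X → X :=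
  if 0 ≤ k then (⇑T)^[k.toNat] else (⇑T.symm)^[(-k).toNat]

lemma iterZ_eq {X : Type*} [MeasurableSpace X] (T : X ≃ᵐ X) (k : ℤ) :
    iterZ T k = ⇑((T.toEquiv : Equiv.Perm X) ^ k) := by
  unfold iterZ
  split_ifs with h
  · obtain ⟨m, rfl⟩ := Int.eq_ofNat_of_zero_le h
    simp only [Int.toNat_natCast, zpow_natCast]
    rw [← Equiv.Perm.iterate_eq_pow]
    rfl
  · obtain ⟨m, hm⟩ := Int.eq_ofNat_of_zero_le (show 0 ≤ -k by omega)
    obtain rfl : k = -(m : ℤ) := by omega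
    simp only [neg_neg, Int.toNat_natCast, zpow_neg, zpow_natCast]
    rw [← inv_pow, ← Equiv.Perm.iterate_eq_pow]
    rfl

lemma iterZ_mp {X : Type*} [MeasurableSpace X] {μ : Measure X} (T : X ≃ᵐ X)
    (hT : MeasurePreserving T μ μ) (k : ℤ) : MeasurePreserving (iterZ T k) μ μ := by
  unfold iterZ
  split_ifs with h
  · exact hT.iterate _
  · exact (hT.symm T).iterate _

lemma iterZ_prod {X : Type*} [MeasurableSpace X] (T : X ≃ᵐ X) (k : ℤ) (y : X × X) :
    iterZ (T.prodCongr T) k y = (iterZ T k y.1, iterZ T k y.2) := by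
  have h : ∀ (f : X → X) (m : ℕ), (Prod.map f f)^[m] y = (f^[m] y.1, f^[m] y.2) := by
    intro f m
    rw [Prod.map_iterate]; rfl
  unfold iterZ
  split_ifs with hk
  · exact h T _
  · exact h T.symm _

lemma iterZ_inter {X : Type*} [MeasurableSpace X] {μ : Measure X} (T : X ≃ᵐ X)
    (hT : MeasurePreserving T μ μ) {B : Set X} (hB : MeasurableSet B) (a b : ℤ) :
    μ (iterZ T (-a) ⁻¹' B ∩ iterZ T (-b) ⁻¹' B) = μ (iterZ T (a - b) '' B ∩ B) := by
  have him : iterZ T (a - b) '' B = iterZ T (-(a - b)) ⁻¹' B := by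
    rw [iterZ_eq, iterZ_eq, zpow_neg]
    exact Equiv.image_eq_preimage_symm _ _
  have hm := (iterZ_mp T hT (-b)).measure_preimage
    (s := iterZ T (-(a - b)) ⁻¹' B ∩ B)
    (((iterZ_mp T hT _).measurable hB).inter hB).nullMeasurableSet
  rw [him, ← hm, Set.preimage_inter, ← Set.preimage_comp]
  congr 3
  rw [iterZ_eq, iterZ_eq, iterZ_eq, ← Equiv.Perm.coe_mul, ← zpow_add]
  congr 2
  ring

lemma sq_int {Y : Type*} [MeasurableSpace Y] (ν : Measure Y) [IsProbabilityMeasure ν]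
    (L : ℕ) (A : ℕ → Set Y) (hA : ∀ i, MeasurableSet (A i)) (q c : ℝ) :
    ∫ y, (q * ∑ i ∈ range L, (A i).indicator (fun _ => (1 : ℝ)) y - c) ^ 2 ∂ν
      = q ^ 2 * ∑ i ∈ range L, ∑ j ∈ range L, ν.real (A i ∩ A j)
        - 2 * q * c * ∑ i ∈ range L, ν.real (A i) + c ^ 2 := by
  have hI : ∀ s : Set Y, MeasurableSet s →
      Integrable (s.indicator (fun _ => (1 : ℝ))) ν := fun s hs =>
    (integrable_const (1 : ℝ)).indicator hs
  have hv : ∀ s : Set Y, MeasurableSet s →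
      ∫ y, s.indicator (fun _ => (1 : ℝ)) y ∂ν = ν.real s := fun s hs => by
    rw [integral_indicator_const _ hs]; simp
  have h2 : Integrable (fun y => ∑ i ∈ range L, ∑ j ∈ range L,
      (A i ∩ A j).indicator (fun _ => (1 : ℝ)) y) ν :=
    integrable_finsetSum _ fun i _ => integrable_finsetSum _ fun j _ =>
      hI _ ((hA i).inter (hA j))
  have h1 : Integrable (fun y => ∑ i ∈ range L, (A i).indicator (fun _ => (1 : ℝ)) y) ν :=
    integrable_finsetSum _ fun i _ => hI _ (hA i)
  have e : ∀ y, (q * ∑ i ∈ range L, (A i).indicator (fun _ => (1 : ℝ)) y - c) ^ 2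
      = q ^ 2 * (∑ i ∈ range L, ∑ j ∈ range L, (A i ∩ A j).indicator (fun _ => (1 : ℝ)) y)
        - 2 * q * c * (∑ i ∈ range L, (A i).indicator (fun _ => (1 : ℝ)) y) + c ^ 2 := by
    intro y
    have : ∑ i ∈ range L, ∑ j ∈ range L, (A i ∩ A j).indicator (fun _ => (1 : ℝ)) y
        = (∑ i ∈ range L, (A i).indicator (fun _ => (1 : ℝ)) y) *
          (∑ i ∈ range L, (A i).indicator (fun _ => (1 : ℝ)) y) := by
      rw [Finset.sum_mul_sum]
      refine Finset.sum_congr rfl fun i _ => Finset.sum_congr rfl fun j _ => ?_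
      by_cases hi : y ∈ A i <;> by_cases hj : y ∈ A j <;> simp [hi, hj]
    rw [this]; ring
  simp_rw [e]
  have h3 : Integrable (fun y => q ^ 2 * (∑ i ∈ range L, ∑ j ∈ range L,
      (A i ∩ A j).indicator (fun _ => (1 : ℝ)) y)
        - 2 * q * c * (∑ i ∈ range L, (A i).indicator (fun _ => (1 : ℝ)) y)) ν :=
    (h2.const_mul _).sub (h1.const_mul _)
  rw [integral_add h3 (integrable_const _),
    integral_sub (h2.const_mul _) (h1.const_mul _), integral_const_mul, integral_const_mul,
    integral_finsetSum _ fun i _ => integrable_finsetSum _ fun j _ =>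
      hI _ ((hA i).inter (hA j)), integral_finsetSum _ fun i _ => hI _ (hA i)]
  simp_rw [integral_finsetSum _ fun j _ => hI _ ((hA _).inter (hA j)), hv _ (hA _),
    hv _ ((hA _).inter (hA _))]
  simp

/-- If for every fixed nonzero integer `i` the sequence `(i·v_n)` mixes the set `B`
with itself, then for every `ε > 0` there are arbitrarily large `L` such that for all
sufficiently large `n` the `L`-block average of `χ_{B×B}∘(T×T)^{-i v_n}` is within `ε`
of `μ(B)²` in the mean. -/
theorem block_average_product_small
    {X : Type*} [MeasurableSpace X] (μ : Measure X) [IsProbabilityMeasure μ]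
    (T : X ≃ᵐ X) (hT : MeasurePreserving T μ μ) (hE : Ergodic (⇑T) μ)
    (B : Set X) (hB : MeasurableSet B)
    (v : ℕ → ℕ) (hv : ∀ n, 0 < v n)
    (hmixB : ∀ i : ℤ, i ≠ 0 →
      Tendsto (fun n : ℕ => (μ (iterZ T (i * (v n : ℤ)) '' B ∩ B)).toReal)
        atTop (nhds ((μ B).toReal * (μ B).toReal))) :
    ∀ ε : ℝ, 0 < ε → ∀ L₀ : ℕ, ∃ L : ℕ, L₀ ≤ L ∧ 0 < L ∧ ∃ N : ℕ, ∀ n, N ≤ n →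
      (∫ y, |(1 / (L : ℝ)) * ∑ i ∈ Finset.range L,
          (B ×ˢ B).indicator (fun _ => (1 : ℝ))
            (iterZ (T.prodCongr T) (-((i : ℤ) * (v n : ℤ))) y)
        - (μ B).toReal * (μ B).toReal| ∂(μ.prod μ)) < ε := by
  intro ε hε L₀
  set b : ℝ := (μ B).toReal with hb
  have hb0 : 0 ≤ b := ENNReal.toReal_nonneg
  have hb1 : b ≤ 1 := measureReal_le_one
  obtain ⟨K, hK⟩ := exists_nat_gt (1 / ε ^ 2)
  refine ⟨max L₀ (K + 1), le_max_left _ _, by positivity, ?_⟩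
  set L := max L₀ (K + 1) with hLdef
  have hL : 0 < (L : ℝ) := by
    have : 0 < L := by positivity
    exact_mod_cast this
  have hLK : (1 : ℝ) / L < ε ^ 2 := by
    have h1 : (K : ℝ) ≤ L := by
      have : K ≤ L := by omega
      exact_mod_cast this
    rw [div_lt_comm₀ hL (by positivity)]
    linarith
  let C : ℕ → ℕ → Set X := fun n i => iterZ T (-((i : ℤ) * (v n : ℤ))) ⁻¹' B
  have hC : ∀ n i, MeasurableSet (C n i) := fun n i => (iterZ_mp T hT _).measurable hB
  have hCm : ∀ n i, μ.real (C n i) = b := fun n i => by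
    rw [Measure.real, (iterZ_mp T hT _).measure_preimage hB.nullMeasurableSet]
  have hind : ∀ n (i : ℕ) (y : X × X), (B ×ˢ B).indicator (fun _ => (1 : ℝ))
      (iterZ (T.prodCongr T) (-((i : ℤ) * (v n : ℤ))) y)
      = (C n i ×ˢ C n i).indicator (fun _ => (1 : ℝ)) y := by
    intro n i y
    rw [iterZ_prod]
    rfl
  simp_rw [hind]
  let F : ℕ → X × X → ℝ := fun n y => (1 / (L : ℝ)) * ∑ i ∈ Finset.range L,
    (C n i ×ˢ C n i).indicator (fun _ => (1 : ℝ)) y - b * b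
  have hF : ∀ n, ∫ y, F n y ^ 2 ∂(μ.prod μ) = (1 / (L : ℝ)) ^ 2 *
      ∑ i ∈ range L, ∑ j ∈ range L, μ.real (C n i ∩ C n j) ^ 2 - (b * b) ^ 2 := by
    intro n
    have := sq_int (μ.prod μ) L (fun i => C n i ×ˢ C n i)
      (fun i => (hC n i).prod (hC n i)) (1 / (L : ℝ)) (b * b)
    simp only [F]
    rw [this]
    simp only [Set.prod_inter_prod, measureReal_prod_prod, hCm]
    simp only [sum_const, card_range, nsmul_eq_mul, ← pow_two]
    field_simp
    ring
  have hlim : Tendsto (fun n => ∫ y, F n y ^ 2 ∂(μ.prod μ)) atTop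
      (nhds ((1 / (L : ℝ)) ^ 2 * ∑ i ∈ range L, ∑ j ∈ range L,
        (if i = j then b else b * b) ^ 2 - (b * b) ^ 2)) := by
    simp_rw [hF]
    refine Tendsto.sub_const (Tendsto.const_mul _ (tendsto_finsetSum _ fun i _ =>
      tendsto_finsetSum _ fun j _ => Tendsto.pow ?_ 2)) _
    split_ifs with hij
    · subst hij
      simp only [Set.inter_self, hCm]
      exact tendsto_const_nhds
    · refine (hmixB ((i : ℤ) - j) (by omega)).congr fun n => ?_
      rw [sub_mul, ← iterZ_inter T hT hB]
      rfl
  have hval : (1 / (L : ℝ)) ^ 2 * ∑ i ∈ range L, ∑ j ∈ range L,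
        (if i = j then b else b * b) ^ 2 - (b * b) ^ 2 < ε ^ 2 := by
    have hs : ∑ i ∈ range L, ∑ j ∈ range L, (if i = j then b else b * b) ^ 2
        ≤ ∑ i ∈ range L, ∑ j ∈ range L, ((if i = j then 1 else 0) + (b * b) ^ 2) := by
      refine sum_le_sum fun i _ => sum_le_sum fun j _ => ?_
      split_ifs
      · nlinarith [sq_nonneg (b * b)]
      · simp
    have hs2 : ∑ i ∈ range L, ∑ j ∈ range L, ((if i = j then (1 : ℝ) else 0) + (b * b) ^ 2)
        = L + L * (L * (b * b) ^ 2) := by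
      simp only [sum_add_distrib, sum_ite_eq, sum_const, card_range, nsmul_eq_mul]
      congr 1
      rw [sum_congr rfl fun i hi => if_pos hi]
      simp
    rw [hs2] at hs
    have := mul_le_mul_of_nonneg_left hs (sq_nonneg (1 / (L : ℝ)))
    have e : (1 / (L : ℝ)) ^ 2 * (L + L * (L * (b * b) ^ 2)) = 1 / L + (b * b) ^ 2 := by
      field_simp
    linarith
  obtain ⟨N, hN⟩ := eventually_atTop.1 (hlim.eventually_lt_const hval)
  refine ⟨N, fun n hn => ?_⟩
  have hlt := hN n hn
  have hmeas : Measurable (F n) := by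
    refine Measurable.sub_const (Measurable.const_mul (Finset.measurable_fun_sum _ fun i _ => ?_) _) _
    exact measurable_const.indicator ((hC n i).prod (hC n i))
  have hInt : Integrable (F n) (μ.prod μ) := by
    refine Integrable.sub (Integrable.const_mul (integrable_finsetSum _ fun i _ => ?_) _)
      (integrable_const _)
    exact (integrable_const (1 : ℝ)).indicator ((hC n i).prod (hC n i))
  have hbd : ∀ y, |F n y| ≤ L + 1 := by
    intro y
    have hS : ∀ i, 0 ≤ (C n i ×ˢ C n i).indicator (fun _ => (1 : ℝ)) y ∧
        (C n i ×ˢ C n i).indicator (fun _ => (1 : ℝ)) y ≤ 1 := fun i => by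
      by_cases h : y ∈ C n i ×ˢ C n i
      · rw [Set.indicator_of_mem h]; norm_num
      · rw [Set.indicator_of_notMem h]; norm_num
    have h0 : 0 ≤ ∑ i ∈ range L, (C n i ×ˢ C n i).indicator (fun _ => (1 : ℝ)) y :=
      sum_nonneg fun i _ => (hS i).1
    have h1 : ∑ i ∈ range L, (C n i ×ˢ C n i).indicator (fun _ => (1 : ℝ)) y ≤ L := by
      refine (sum_le_sum fun i _ => (hS i).2).trans ?_
      simp
    have h2 : (1 / (L : ℝ)) * ∑ i ∈ range L, (C n i ×ˢ C n i).indicator (fun _ => (1 : ℝ)) y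
        ≤ 1 := by
      rw [one_div_mul_eq_div, div_le_one hL]; exact h1
    have h3 : 0 ≤ (1 / (L : ℝ)) *
        ∑ i ∈ range L, (C n i ×ˢ C n i).indicator (fun _ => (1 : ℝ)) y := by positivity
    rw [abs_le]
    constructor <;> simp only [F] <;> nlinarith
  have hInt2 : Integrable (fun y => F n y ^ 2) (μ.prod μ) := by
    refine Integrable.of_bound (hmeas.pow_const 2).aestronglyMeasurable (((L : ℝ) + 1) ^ 2)
      (Eventually.of_forall fun y => ?_)
    rw [norm_pow, Real.norm_eq_abs]
    exact pow_le_pow_left₀ (abs_nonneg _) (hbd y) 2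
  have key : ∫ y, |F n y| ∂(μ.prod μ) ≤
      ∫ y, ((1 / (2 * ε)) * F n y ^ 2 + ε / 2) ∂(μ.prod μ) := by
    refine integral_mono hInt.abs ((hInt2.const_mul _).add (integrable_const _)) fun y => ?_
    have h : (1 / (2 * ε)) * F n y ^ 2 + ε / 2 - |F n y| = (1 / (2 * ε)) * (|F n y| - ε) ^ 2 := by
      rw [← sq_abs (F n y)]
      field_simp
      ring
    have h' : 0 ≤ (1 / (2 * ε)) * (|F n y| - ε) ^ 2 := by positivity
    change |F n y| ≤ (1 / (2 * ε)) * F n y ^ 2 + ε / 2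
    linarith
  rw [integral_add (hInt2.const_mul _) (integrable_const _), integral_const_mul] at key
  simp only [integral_const, probReal_univ, one_smul] at key
  have h5 : (1 / (2 * ε)) * ∫ y, F n y ^ 2 ∂(μ.prod μ) < (1 / (2 * ε)) * ε ^ 2 :=
    mul_lt_mul_of_pos_left hlt (by positivity)
  have h6 : (1 / (2 * ε)) * ε ^ 2 = ε / 2 := by field_simp
  calc _ = ∫ y, |F n y| ∂(μ.prod μ) := rfl
    _ < ε := by linarith
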